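/- Let (P_α)_{α ∈ I} be a family of fields, let K be the product ring Π_{α ∈ I} P_α, let n ≥ 1, and let G be a subgroup of GL_n(K). Then the subgroup H of G generated by all nil-elements of G is a solvable, locally nilpotent normal subgroup of G; in particular every nil-element of G lies in a locally nilpotent normal subgroup of G. -/

import Mathlib

/-- Engel words with the convention of the paper: the commutator is
`[x, y] = x⁻¹ * y⁻¹ * x * y`, `engelWord 0 x y = x` and
`engelWord (n+1) x y = [engelWord n x y, y]`; thus for `n ≥ 1`,
`engelWord n x y` is the Engel word `e_n(x, y)`. -/
def engelWord {G : Type*} [Group G] : ℕ → G → G → G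
  | 0, x, _ => x
  | n + 1, x, y => (engelWord n x y)⁻¹ * y⁻¹ * engelWord n x y * y

/-- Iterated Engel words: `epsEngel [(n₁,a₁),…,(n_k,a_k)] y` is
`ε_{(n₁,…,n_k)}(a₁,…,a_k; y)`, defined by `ε_{(n₁)}(a₁;y) = e_{n₁}(a₁,y)` and
`ε_{(n₁,…,n_k)}(a₁,…,a_k;y) = e_{n_k}(a_k, ε_{(n₁,…,n_{k-1})}(a₁,…,a_{k-1};y))`. -/
def epsEngel {G : Type*} [Group G] (l : List (ℕ × G)) (y : G) : G :=
  l.foldl (fun z p => engelWord p.1 p.2 z) y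

/-- `g` is a nil-element if for every `a` there is `n ≥ 1` with `e_n(a, g) = 1`. -/
def IsNilElement {G : Type*} [Group G] (g : G) : Prop :=
  ∀ a : G, ∃ n, 1 ≤ n ∧ engelWord n a g = 1

/-- A group is locally nilpotent if every finitely generated subgroup is nilpotent. -/
def LocallyNilpotent (G : Type*) [Group G] : Prop :=
  ∀ H : Subgroup G, H.FG → Group.IsNilpotent H

/-- `g` is quasi-nil of order ≤ `k`: there are functions `ν i : G^(i+1) → ℕ` (with values ≥ 1,
`ν i` depending only on `a₁,…,a_{i+1}` and `g`) such that for all `a : Fin k → G`,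
`ε_{(ν₁(a₁),…,ν_k(a₁,…,a_k))}(a₁,…,a_k; g) = 1`. -/
def IsQuasiNilOfOrder {G : Type*} [Group G] (k : ℕ) (g : G) : Prop :=
  ∃ ν : ∀ i : Fin k, (Fin ((i : ℕ) + 1) → G) → ℕ,
    (∀ i f, 1 ≤ ν i f) ∧
    ∀ a : Fin k → G,
      epsEngel (List.ofFn fun i : Fin k =>
        (ν i fun j => a (Fin.castLE i.isLt j), a i)) g = 1

/-- `g` is quasi-nil if it is quasi-nil of order ≤ `k` for some `k ≥ 1`. -/
def IsQuasiNil {G : Type*} [Group G] (g : G) : Prop :=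
  ∃ k, 1 ≤ k ∧ IsQuasiNilOfOrder k g

/-- `g` maps to a nil-element of the quotient `G ⧸ N` (for `N` normal). -/
def IsNilElementQuot {G : Type*} [Group G] (N : Subgroup G) (hN : N.Normal) (g : G) : Prop :=
  @IsNilElement (G ⧸ N) (@QuotientGroup.Quotient.group G _ N hN) (QuotientGroup.mk g)

theorem map_engelWord {G H : Type*} [Group G] [Group H] (f : G →* H) (n : ℕ) (a g : G) :
    f (engelWord n a g) = engelWord n (f a) (f g) := by
  induction n with
  | zero => rfl
  | succ n ih => simp [engelWord, ih]

theorem IsNilElement.map {G H : Type*} [Group G] [Group H] {f : G →* H}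
    (hf : Function.Surjective f) {g : G} (hg : IsNilElement g) : IsNilElement (f g) := by
  intro b
  obtain ⟨a, rfl⟩ := hf b
  obtain ⟨n, hn, h⟩ := hg a
  exact ⟨n, hn, by rw [← map_engelWord, h, map_one]⟩

theorem IsNilElement.of_map {G H : Type*} [Group G] [Group H] {f : G →* H}
    (hf : Function.Injective f) {g : G} (hg : IsNilElement (f g)) : IsNilElement g := by
  intro a
  obtain ⟨n, hn, h⟩ := hg (f a)
  exact ⟨n, hn, hf (by rw [map_engelWord, h, map_one])⟩

theorem IsNilElement.conj {G : Type*} [Group G] {g : G} (hg : IsNilElement g) (x : G) :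
    IsNilElement (x * g * x⁻¹) :=
  hg.map (f := (MulAut.conj x).toMonoidHom) (MulAut.conj x).surjective

/-- A nontrivial subgroup normalized by a nil-element `s` meets the centralizer of `s`. -/
theorem IsNilElement.exists_commute_mem {G : Type*} [Group G] {s : G} (hs : IsNilElement s)
    {N : Subgroup G} (hN : ∀ a ∈ N, s⁻¹ * a * s ∈ N) (hbot : N ≠ ⊥) :
    ∃ a ∈ N, a ≠ 1 ∧ Commute a s := by
  classical
  obtain ⟨b, hbN, hb⟩ := N.bot_or_exists_ne_one.resolve_left hbot
  have hmem : ∀ n, engelWord n b s ∈ N := by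
    intro n
    induction n with
    | zero => exact hbN
    | succ n ih =>
      simp only [engelWord]
      have := N.mul_mem (N.inv_mem ih) (hN _ ih)
      simpa [mul_assoc] using this
  have hex : ∃ n, engelWord n b s = 1 := (hs b).imp fun _ h => h.2
  obtain ⟨m, hm⟩ : ∃ m, Nat.find hex = m + 1 := by
    refine Nat.exists_eq_succ_of_ne_zero fun h0 => hb ?_
    have := Nat.find_spec hex
    rwa [h0] at this
  have h1 := Nat.find_spec hex
  rw [hm] at h1
  refine ⟨engelWord m b s, hmem m, Nat.find_min hex (by omega), ?_⟩
  simp only [engelWord] at h1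
  rw [← mul_inv_rev, mul_assoc, inv_mul_eq_one] at h1
  exact h1.symm

/-- The left-normed commutators of weight `k + 1` in the elements of `S`. -/
def iteratedCommutators {G : Type*} [Group G] (S : Set G) : ℕ → Set G
  | 0 => S
  | k + 1 => Set.image2 (fun y s => y⁻¹ * s⁻¹ * y * s) (iteratedCommutators S k) S

theorem finite_iteratedCommutators {G : Type*} [Group G] {S : Set G} (hS : S.Finite) (k : ℕ) :
    (iteratedCommutators S k).Finite := by
  induction k with
  | zero => exact hS
  | succ k ih => exact ih.image2 _ hS

theorem iteratedCommutators_subset_lowerCentralSeries {G : Type*} [Group G] (S : Set G) (k : ℕ) :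
    iteratedCommutators S k ⊆ (⊤ : Subgroup G).lowerCentralSeries k := by
  induction k with
  | zero => simp [iteratedCommutators]
  | succ k ih =>
    rintro _ ⟨y, hy, s, -, rfl⟩
    rw [Subgroup.lowerCentralSeries_succ]
    have := Subgroup.commutator_mem_commutator (H₁ := (⊤ : Subgroup G).lowerCentralSeries k)
      (H₂ := ⊤) (inv_mem (ih hy)) (Subgroup.mem_top s⁻¹)
    simpa [commutatorElement_def] using this

theorem image_iteratedCommutators {G H : Type*} [Group G] [Group H] (f : G →* H) (S : Set G)
    (k : ℕ) : f '' iteratedCommutators S k = iteratedCommutators (f '' S) k := by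
  induction k with
  | zero => rfl
  | succ k ih =>
    simp only [iteratedCommutators, ← ih]
    exact Set.image_image2_distrib (by simp)

section

variable {G : Type*} [Group G]

/-- If `x` is a commutator in nil-elements acting centrally on the nontrivial
normal subgroup `N`, then `x` centralizes a smaller nontrivial normal subgroup. -/
theorem exists_normal_le_centralizer_singleton {S : Set G} (hS : Subgroup.closure S = ⊤)
    (hnil : ∀ s ∈ S, IsNilElement s) {k : ℕ} {N : Subgroup G} [hN : N.Normal] (hbot : N ≠ ⊥)
    (hcent : iteratedCommutators S (k + 1) ⊆ Subgroup.centralizer (N : Set G)) {x : G}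
    (hx : x ∈ iteratedCommutators S k) :
    ∃ N' ≤ N, N'.Normal ∧ N' ≠ ⊥ ∧ N' ≤ Subgroup.centralizer {x} := by
  set K := Subgroup.centralizer (N : Set G) with hK
  have hxg : ∀ g : G, Commute (x : G ⧸ K) (g : G ⧸ K) := by
    have : (⊤ : Subgroup G) ≤ (Subgroup.centralizer {(x : G ⧸ K)}).comap (QuotientGroup.mk' K) := by
      rw [← hS, Subgroup.closure_le]
      intro s hs
      have h1 : x⁻¹ * s⁻¹ * x * s ∈ K := hcent ⟨x, hx, s, hs, rfl⟩
      rw [← QuotientGroup.eq_one_iff] at h1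
      simp only [QuotientGroup.mk_mul, QuotientGroup.mk_inv] at h1
      simp only [SetLike.mem_coe, Subgroup.mem_comap, Subgroup.mem_centralizer_singleton_iff,
        QuotientGroup.mk'_apply]
      rw [← mul_inv_rev, mul_assoc, inv_mul_eq_one] at h1
      exact h1
    intro g
    have := this (Subgroup.mem_top g)
    rw [Subgroup.mem_comap, Subgroup.mem_centralizer_singleton_iff] at this
    exact this.symm
  have hconj : ∀ g : G, ∀ m ∈ N, x * (g * m * g⁻¹) * x⁻¹ = g * (x * m * x⁻¹) * g⁻¹ := by
    intro g m hm
    have h1 : (g * x)⁻¹ * (x * g) ∈ K := by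
      rw [← QuotientGroup.eq]
      simpa using (hxg g).eq.symm
    have h2 := Subgroup.mem_centralizer_iff.mp h1 m hm
    have : x * g * m = g * x * m * ((g * x)⁻¹ * (x * g)) := by
      rw [mul_assoc (g * x), h2]; group
    calc x * (g * m * g⁻¹) * x⁻¹ = x * g * m * (g⁻¹ * x⁻¹) := by group
      _ = g * (x * m * x⁻¹) * g⁻¹ := by rw [this]; group
  refine ⟨N ⊓ Subgroup.centralizer {x}, inf_le_left, ⟨?_⟩, ?_, inf_le_right⟩
  · intro m hm g
    rw [Subgroup.mem_inf, Subgroup.mem_centralizer_singleton_iff] at hm ⊢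
    obtain ⟨hm, hmx⟩ := hm
    refine ⟨hN.conj_mem m hm g, ?_⟩
    have h := hconj g m hm
    rw [← hmx, mul_inv_cancel_right] at h
    exact (mul_inv_eq_iff_eq_mul.mp h).symm
  · suffices ∃ a ∈ N, a ≠ 1 ∧ Commute a x by
      obtain ⟨a, ha, ha1, hax⟩ := this
      refine fun h => ha1 ?_
      have : a ∈ N ⊓ Subgroup.centralizer {x} :=
        ⟨ha, Subgroup.mem_centralizer_singleton_iff.mpr hax.eq⟩
      rwa [h, Subgroup.mem_bot] at this
    have hNconj : ∀ g : G, ∀ a ∈ N, g⁻¹ * a * g ∈ N := fun g a ha => by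
      simpa using hN.conj_mem a ha g⁻¹
    cases k with
    | zero => exact (hnil x hx).exists_commute_mem (hNconj x) hbot
    | succ k =>
      obtain ⟨y, -, s, hs, rfl⟩ := hx
      beta_reduce at hconj ⊢
      obtain ⟨a, ha, ha1, has⟩ := (hnil s hs).exists_commute_mem (hNconj s) hbot
      have ht : IsNilElement (y⁻¹ * s * y) := by simpa using (hnil s hs).conj y⁻¹
      have hN1 : N ⊓ Subgroup.centralizer {s} ≠ ⊥ := fun h => ha1 <| by
        have : a ∈ N ⊓ Subgroup.centralizer {s} :=
          ⟨ha, Subgroup.mem_centralizer_singleton_iff.mpr has.eq⟩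
        rwa [h, Subgroup.mem_bot] at this
      obtain ⟨b, ⟨hb, hbs⟩, hb1, hbt⟩ := ht.exists_commute_mem (N := N ⊓ Subgroup.centralizer {s})
        (by
          intro m hm
          rw [Subgroup.mem_inf, Subgroup.mem_centralizer_singleton_iff] at hm ⊢
          obtain ⟨hm, hms⟩ := hm
          refine ⟨hNconj _ m hm, ?_⟩
          have h := hconj s m hm
          rw [← hms, mul_inv_cancel_right] at h
          have e : (y⁻¹ * s * y)⁻¹ * m * (y⁻¹ * s * y) =
              (y⁻¹ * s⁻¹ * y * s) * m * (y⁻¹ * s⁻¹ * y * s)⁻¹ := by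
            have : s⁻¹⁻¹ * m * s⁻¹ = m := by rw [inv_inv, ← hms, mul_inv_cancel_right]
            calc _ = (y⁻¹ * s⁻¹ * y) * m * (y⁻¹ * s⁻¹ * y)⁻¹ := by group
              _ = (y⁻¹ * s⁻¹ * y) * (s⁻¹⁻¹ * m * s⁻¹) * (y⁻¹ * s⁻¹ * y)⁻¹ := by rw [this]
              _ = _ := by group
          rw [e]
          exact eq_mul_of_mul_inv_eq h.symm |>.symm)
        hN1
      refine ⟨b, hb, hb1, ?_⟩
      have hbs' : Commute b s := Subgroup.mem_centralizer_singleton_iff.mp hbs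
      have : y⁻¹ * s⁻¹ * y * s = (y⁻¹ * s * y)⁻¹ * s := by group
      rw [this]
      exact hbt.inv_right.mul_right hbs'

theorem exists_normal_le_centralizer_finite {S : Set G} (hS : Subgroup.closure S = ⊤)
    (hnil : ∀ s ∈ S, IsNilElement s) {k : ℕ} {N : Subgroup G} [hN : N.Normal] (hbot : N ≠ ⊥)
    (hcent : iteratedCommutators S (k + 1) ⊆ Subgroup.centralizer (N : Set G)) {X : Set G}
    (hX : X.Finite) (hXS : X ⊆ iteratedCommutators S k) :
    ∃ N' ≤ N, N'.Normal ∧ N' ≠ ⊥ ∧ X ⊆ Subgroup.centralizer (N' : Set G) := by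
  induction X, hX using Set.Finite.induction_on with
  | empty => exact ⟨N, le_rfl, hN, hbot, Set.empty_subset _⟩
  | @insert x X _ _ ih =>
    obtain ⟨N₁, h₁N, h₁n, h₁b, h₁X⟩ := ih ((Set.subset_insert _ _).trans hXS)
    obtain ⟨N₂, h₂N, h₂n, h₂b, h₂x⟩ := exists_normal_le_centralizer_singleton hS hnil h₁b
      (hcent.trans (Subgroup.centralizer_le h₁N)) (hXS (Set.mem_insert _ _))
    refine ⟨N₂, h₂N.trans h₁N, h₂n, h₂b, Set.insert_subset ?_
      (h₁X.trans (Subgroup.centralizer_le h₂N))⟩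
    rw [SetLike.mem_coe, Subgroup.mem_centralizer_iff]
    exact fun m hm => Subgroup.mem_centralizer_singleton_iff.mp (h₂x hm)

/-- A nontrivial normal subgroup on which the iterated commutators of some weight of a finite
generating set of nil-elements act trivially meets the center. -/
theorem center_ne_bot_of_iteratedCommutators_subset_centralizer {S : Set G} (hfin : S.Finite)
    (hS : Subgroup.closure S = ⊤) (hnil : ∀ s ∈ S, IsNilElement s) (k : ℕ) (N : Subgroup G)
    [hN : N.Normal] (hbot : N ≠ ⊥)
    (hcent : iteratedCommutators S k ⊆ Subgroup.centralizer (N : Set G)) :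
    Subgroup.center G ≠ ⊥ := by
  induction k generalizing N with
  | zero =>
    have : (⊤ : Subgroup G) ≤ Subgroup.centralizer (N : Set G) := by
      rw [← hS, Subgroup.closure_le]; exact hcent
    have h : N ≤ Subgroup.center G := fun m hm => Subgroup.mem_center_iff.mpr fun g =>
      (Subgroup.mem_centralizer_iff.mp (this (Subgroup.mem_top g)) m hm).symm
    exact fun hc => hbot (le_bot_iff.mp (h.trans hc.le))
  | succ k ih =>
    obtain ⟨N', -, hn, hb, hX⟩ := exists_normal_le_centralizer_finite hS hnil hbot hcent
      (finite_iteratedCommutators hfin k) subset_rfl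
    exact ih N' hb hX

end

/-- For a finitely generated group, the quotient by the union of the finite terms of the
upper central series has trivial center. -/
theorem center_quotient_iSup_upperCentralSeries {G : Type*} [Group G] {S : Set G} (hfin : S.Finite)
    (hS : Subgroup.closure S = ⊤) :
    Subgroup.center (G ⧸ ⨆ n, Subgroup.upperCentralSeries G n) = ⊥ := by
  have hdir : Directed (· ≤ ·) (Subgroup.upperCentralSeries G) :=
    (Subgroup.upperCentralSeries_mono G).directed_le
  rw [eq_bot_iff]
  intro q hq
  induction q using QuotientGroup.induction_on with | H z => ?_
  rw [Subgroup.mem_bot, QuotientGroup.eq_one_iff]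
  have h1 : ∀ s : G, ∃ n, s⁻¹ * z⁻¹ * s * z ∈ Subgroup.upperCentralSeries G n := by
    intro s
    rw [← Subgroup.mem_iSup_of_directed hdir, ← QuotientGroup.eq_one_iff]
    have := Subgroup.mem_center_iff.mp hq s
    simp only [QuotientGroup.mk_mul, QuotientGroup.mk_inv]
    rw [← mul_inv_rev, mul_assoc, inv_mul_eq_one]
    exact this.symm
  choose f hf using h1
  obtain ⟨n, hn⟩ := (hfin.image f).bddAbove
  have h2 : ∀ s ∈ S, s⁻¹ * z⁻¹ * s * z ∈ Subgroup.upperCentralSeries G n := fun s hs =>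
    Subgroup.upperCentralSeries_mono G (hn (Set.mem_image_of_mem f hs)) (hf s)
  have h3 : (⊤ : Subgroup G) ≤ (Subgroup.centralizer
      {(z : G ⧸ Subgroup.upperCentralSeries G n)}).comap (QuotientGroup.mk' _) := by
    rw [← hS, Subgroup.closure_le]
    intro s hs
    have := (QuotientGroup.eq_one_iff _).mpr (h2 s hs)
    simp only [QuotientGroup.mk_mul, QuotientGroup.mk_inv] at this
    rw [← mul_inv_rev, mul_assoc, inv_mul_eq_one] at this
    simpa [Subgroup.mem_centralizer_singleton_iff] using this.symm
  refine Subgroup.mem_iSup_of_mem (n + 1) ?_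
  change z ∈ Subgroup.upperCentralSeriesStep (Subgroup.upperCentralSeries G n)
  rw [Subgroup.upperCentralSeriesStep_eq_comap_center, Subgroup.mem_comap, Subgroup.mem_center_iff]
  intro g
  induction g using QuotientGroup.induction_on with | H g => ?_
  exact Subgroup.mem_centralizer_singleton_iff.mp (h3 (Subgroup.mem_top g))

/-- A finitely generated group is nilpotent if the quotient by the union of the finite terms of its
upper central series is trivial as soon as it has trivial center. -/
theorem isNilpotent_of_subsingleton_quotient_iSup_upperCentralSeries {G : Type*} [Group G]
    {S : Set G} (hfin : S.Finite) (hS : Subgroup.closure S = ⊤)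
    (h : Subsingleton (G ⧸ ⨆ n, Subgroup.upperCentralSeries G n)) : Group.IsNilpotent G := by
  have hmem : ∀ s : G, ∃ n, s ∈ Subgroup.upperCentralSeries G n := by
    intro s
    rw [← Subgroup.mem_iSup_of_directed (Subgroup.upperCentralSeries_mono G).directed_le,
      ← QuotientGroup.eq_one_iff]
    exact Subsingleton.elim _ _
  choose f hf using hmem
  obtain ⟨n, hn⟩ := (hfin.image f).bddAbove
  refine ⟨n, top_le_iff.mp ?_⟩
  rw [← hS, Subgroup.closure_le]
  exact fun s hs => Subgroup.upperCentralSeries_mono G (hn (Set.mem_image_of_mem f hs)) (hf s)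

theorem closure_image_mk'_eq_top {G : Type*} [Group G] {S : Set G}
    (hS : Subgroup.closure S = ⊤) (A : Subgroup G) [A.Normal] :
    Subgroup.closure (QuotientGroup.mk' A '' S) = ⊤ := by
  rw [← MonoidHom.map_closure, hS, ← MonoidHom.range_eq_map]
  exact MonoidHom.range_eq_top_of_surjective _ (QuotientGroup.mk'_surjective A)

theorem forall_isNilElement_image_mk' {G : Type*} [Group G] {S : Set G}
    (hnil : ∀ s ∈ S, IsNilElement s) (A : Subgroup G) [A.Normal] :
    ∀ s ∈ QuotientGroup.mk' A '' S, IsNilElement s := by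
  rintro _ ⟨s, hs, rfl⟩
  exact (hnil s hs).map (QuotientGroup.mk'_surjective A)

/-- **Gruenberg**: a solvable group generated by finitely many nil-elements is nilpotent. -/
theorem isNilpotent_of_derivedSeries_eq_bot (d : ℕ) {G : Type*} [Group G] {S : Set G}
    (hfin : S.Finite) (hS : Subgroup.closure S = ⊤) (hnil : ∀ s ∈ S, IsNilElement s)
    (hd : derivedSeries G d = ⊥) : Group.IsNilpotent G := by
  induction d generalizing G with
  | zero =>
    rw [derivedSeries_zero] at hd
    have := Subgroup.subsingleton_iff.mp (subsingleton_of_bot_eq_top hd.symm)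
    infer_instance
  | succ d ih =>
    refine isNilpotent_of_subsingleton_quotient_iSup_upperCentralSeries hfin hS ?_
    by_contra hQ
    rw [not_subsingleton_iff_nontrivial] at hQ
    have hcenter := center_quotient_iSup_upperCentralSeries hfin hS
    have hdQ := map_derivedSeries_eq (QuotientGroup.mk'_surjective
      (⨆ n, Subgroup.upperCentralSeries G n)) (d + 1)
    rw [hd, Subgroup.map_bot] at hdQ
    have hfinQ := hfin.image (QuotientGroup.mk' (⨆ n, Subgroup.upperCentralSeries G n))
    have hSQ := closure_image_mk'_eq_top hS (⨆ n, Subgroup.upperCentralSeries G n)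
    have hnilQ := forall_isNilElement_image_mk' hnil (⨆ n, Subgroup.upperCentralSeries G n)
    generalize QuotientGroup.mk' (⨆ n, Subgroup.upperCentralSeries G n) '' S = T at *
    by_cases hA : derivedSeries (G ⧸ ⨆ n, Subgroup.upperCentralSeries G n) d = ⊥
    · have := ih hfinQ hSQ hnilQ hA
      exact Group.IsNilpotent.center_ne_bot _ hcenter
    · have hnorm := derivedSeries_normal (G ⧸ ⨆ n, Subgroup.upperCentralSeries G n) d
      have hcomm := Subgroup.commutator_eq_bot_iff_le_centralizer.mp hdQ.symm
      generalize hA' : derivedSeries (G ⧸ ⨆ n, Subgroup.upperCentralSeries G n) d = A at *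
      have hnilp : Group.IsNilpotent ((G ⧸ ⨆ n, Subgroup.upperCentralSeries G n) ⧸ A) := by
        refine ih (hfinQ.image _) (closure_image_mk'_eq_top hSQ A)
          (forall_isNilElement_image_mk' hnilQ A) ?_
        rw [← map_derivedSeries_eq (QuotientGroup.mk'_surjective A), hA', Subgroup.map_eq_bot_iff,
          QuotientGroup.ker_mk']
      obtain ⟨c, hc⟩ := Subgroup.nilpotent_iff_lowerCentralSeries.mp hnilp
      refine center_ne_bot_of_iteratedCommutators_subset_centralizer hfinQ hSQ hnilQ c A hA
        (Set.Subset.trans ?_ hcomm) hcenter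
      intro x hx
      have h1 := iteratedCommutators_subset_lowerCentralSeries _ c
        ((image_iteratedCommutators (QuotientGroup.mk' A) T c).subset (Set.mem_image_of_mem _ hx))
      rw [hc] at h1
      exact (QuotientGroup.eq_one_iff x).mp h1

theorem exists_finite_subset_mem_closure {G : Type*} [Group G] {S : Set G} {x : G}
    (hx : x ∈ Subgroup.closure S) : ∃ T ⊆ S, T.Finite ∧ x ∈ Subgroup.closure T := by
  induction hx using Subgroup.closure_induction with
  | mem x hx => exact ⟨{x}, by simpa, Set.finite_singleton x, Subgroup.mem_closure_singleton_self x⟩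
  | one => exact ⟨∅, Set.empty_subset _, Set.finite_empty, one_mem _⟩
  | mul x y _ _ hx hy =>
    obtain ⟨T, hTS, hT, hxT⟩ := hx
    obtain ⟨U, hUS, hU, hyU⟩ := hy
    exact ⟨T ∪ U, Set.union_subset hTS hUS, hT.union hU,
      mul_mem (Subgroup.closure_mono Set.subset_union_left hxT)
        (Subgroup.closure_mono Set.subset_union_right hyU)⟩
  | inv x _ hx =>
    obtain ⟨T, hTS, hT, hxT⟩ := hx
    exact ⟨T, hTS, hT, inv_mem hxT⟩

theorem exists_finite_subset_closure_le {G : Type*} [Group G] {S F : Set G} (hF : F.Finite)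
    (hFS : F ⊆ Subgroup.closure S) :
    ∃ T ⊆ S, T.Finite ∧ Subgroup.closure F ≤ Subgroup.closure T := by
  choose! T hTS hT hx using fun x (hx : x ∈ Subgroup.closure S) =>
    exists_finite_subset_mem_closure hx
  refine ⟨⋃ x ∈ F, T x, Set.iUnion₂_subset fun x hx => hTS x (hFS hx),
    hF.biUnion fun x hx => hT x (hFS hx), ?_⟩
  rw [Subgroup.closure_le]
  exact fun x hxF => Subgroup.closure_mono (Set.subset_biUnion_of_mem hxF) (hx x (hFS hxF))

/-- A solvable group generated by nil-elements is locally nilpotent. -/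
theorem locallyNilpotent_of_closure_eq_top {G : Type*} [Group G] [hG : Group.IsSolvable G]
    {S : Set G} (hS : Subgroup.closure S = ⊤) (hnil : ∀ s ∈ S, IsNilElement s) :
    LocallyNilpotent G := by
  intro H ⟨F, hF⟩
  obtain ⟨d, hd⟩ := hG
  obtain ⟨T, hTS, hT, hHT⟩ : ∃ T ⊆ S, T.Finite ∧ H ≤ Subgroup.closure T := by
    have := exists_finite_subset_closure_le (F := F) (S := S) F.finite_toSet (by simp [hS])
    rwa [hF] at this
  have hnilp : Group.IsNilpotent (Subgroup.closure T) := by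
    refine isNilpotent_of_derivedSeries_eq_bot d
      (S := ((↑) : Subgroup.closure T → G) ⁻¹' T) (hT.preimage Subtype.val_injective.injOn)
      (Subgroup.closure_closure_coe_preimage) ?_ ?_
    · intro s hs
      exact IsNilElement.of_map (f := (Subgroup.closure T).subtype) Subtype.val_injective
        (hnil _ (hTS hs))
    · have := map_derivedSeries_le_derivedSeries (Subgroup.closure T).subtype d
      rw [hd, le_bot_iff] at this
      exact (Subgroup.map_eq_bot_iff_of_injective _ Subtype.val_injective).mp this
  exact Subgroup.isNilpotent_of_ker_le_center (Subgroup.inclusion hHT)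
    (by rw [(Subgroup.inclusion hHT).ker_eq_bot (Subgroup.inclusion_injective hHT)]; exact bot_le)

/-- The subgroup generated by the nil-elements of `G` lying in `W`. -/
def nilPart {G : Type*} [Group G] (W : Subgroup G) : Subgroup G :=
  Subgroup.closure {g | IsNilElement g ∧ g ∈ W}

section

variable {G : Type*} [Group G]

theorem nilPart_le (W : Subgroup G) : nilPart W ≤ W :=
  (Subgroup.closure_le _).mpr fun _ h => h.2

theorem IsNilElement.mem_nilPart {W : Subgroup G} {g : G} (hg : IsNilElement g) (h : g ∈ W) :
    g ∈ nilPart W :=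
  Subgroup.subset_closure ⟨hg, h⟩

theorem nilPart_mono {W W' : Subgroup G} (h : W ≤ W') : nilPart W ≤ nilPart W' :=
  Subgroup.closure_mono fun _ hg => ⟨hg.1, h hg.2⟩

theorem nilPart_nilPart (W : Subgroup G) : nilPart (nilPart W) = nilPart W :=
  le_antisymm (nilPart_le _) <|
    (Subgroup.closure_le _).mpr fun _ h => h.1.mem_nilPart (h.1.mem_nilPart h.2)

theorem closure_isNilElement_nilPart (W : Subgroup G) :
    Subgroup.closure {g : nilPart W | IsNilElement g} = ⊤ := by
  refine top_le_iff.mp (Subgroup.closure_closure_coe_preimage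
    (k := {g | IsNilElement g ∧ g ∈ W}).ge.trans (Subgroup.closure_mono fun g hg => ?_))
  exact IsNilElement.of_map (f := (nilPart W).subtype) Subtype.val_injective hg.1

theorem nilPart_map_conj (W : Subgroup G) (g : G) :
    nilPart (W.map (MulAut.conj g).toMonoidHom) = (nilPart W).map (MulAut.conj g).toMonoidHom := by
  rw [nilPart, nilPart, MonoidHom.map_closure]
  congr 1
  ext x
  constructor
  · rintro ⟨hx, w, hw, rfl⟩
    refine ⟨w, ⟨?_, hw⟩, rfl⟩
    exact IsNilElement.of_map (f := (MulAut.conj g).toMonoidHom) (MulAut.conj g).injective hx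
  · rintro ⟨w, ⟨hwn, hw⟩, rfl⟩
    exact ⟨hwn.map (f := (MulAut.conj g).toMonoidHom) (MulAut.conj g).surjective, w, hw, rfl⟩

theorem normalizer_le_normalizer_nilPart (W : Subgroup G) :
    Subgroup.normalizer (W : Set G) ≤ Subgroup.normalizer (nilPart W : Set G) := by
  intro g hg
  rw [Subgroup.mem_normalizer_iff_map_conj_eq] at hg ⊢
  exact (nilPart_map_conj W g).symm.trans (congrArg nilPart hg)

theorem isNilpotent_of_finite_of_isSolvable [Finite G] [h : Group.IsSolvable G]
    (hG : Subgroup.closure {g : G | IsNilElement g} = ⊤) : Group.IsNilpotent G := by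
  obtain ⟨d, hd⟩ := h
  exact isNilpotent_of_derivedSeries_eq_bot d (Set.toFinite _) hG (fun _ h => h) hd

/-- If `U` is nilpotent and `D` is generated by the nil-elements in `U ∩ V`, then some nil-element
of `U` outside `V` normalizes `D`. -/
theorem exists_isNilElement_mem_normalizer [Finite G] {U V : Subgroup G} [Group.IsNilpotent U]
    (hU : nilPart U = U) (hUV : ¬ U ≤ V) :
    ∃ u ∈ U, IsNilElement u ∧ u ∉ V ∧ u ∈ Subgroup.normalizer (nilPart (U ⊓ V) : Set G) := by
  obtain ⟨E, hDE, hE⟩ := (Set.toFinite {E : Subgroup G | E ≤ U ∧ nilPart E ≤ V}).exists_le_maximal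
    (a := nilPart (U ⊓ V))
    ⟨(nilPart_le _).trans inf_le_left, (nilPart_le _).trans ((nilPart_le _).trans inf_le_right)⟩
  obtain ⟨hEU, hEV⟩ := hE.prop
  have hD : nilPart (U ⊓ V) = nilPart E := by
    refine le_antisymm ?_ ?_
    · rw [← nilPart_nilPart (U ⊓ V)]; exact nilPart_mono hDE
    · rw [← nilPart_nilPart E]
      exact nilPart_mono (le_inf ((nilPart_le _).trans hEU) hEV)
  have hlt : E.subgroupOf U < ⊤ := by
    rw [lt_top_iff_ne_top, Ne, Subgroup.subgroupOf_eq_top]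
    intro h
    exact hUV (hU ▸ (nilPart_mono h).trans hEV)
  obtain ⟨-, w, hw, hwE⟩ := SetLike.lt_iff_le_and_exists.mp
    (Group.normalizerCondition_of_isNilpotent _ hlt)
  have hw' : (w : G) ∈ Subgroup.normalizer (E : Set G) := by
    rw [Subgroup.mem_normalizer_iff] at hw ⊢
    intro h
    constructor
    · intro hh
      exact (hw ⟨h, hEU hh⟩).mp hh
    · intro hh
      have hhU : h ∈ U := by
        have := U.mul_mem (U.mul_mem (U.inv_mem w.2) (hEU hh)) w.2
        simpa [mul_assoc] using this
      exact (hw ⟨h, hhU⟩).mpr hh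
  have hlt' : E < U ⊓ Subgroup.normalizer (E : Set G) :=
    SetLike.lt_iff_le_and_exists.mpr ⟨le_inf hEU Subgroup.le_normalizer,
      (w : G), Subgroup.mem_inf.mpr ⟨w.2, hw'⟩, hwE⟩
  have hnot : ¬ nilPart (U ⊓ Subgroup.normalizer (E : Set G)) ≤ V := fun h =>
    hlt'.not_ge (hE.le_of_ge ⟨inf_le_left, h⟩ hlt'.le)
  rw [nilPart, Subgroup.closure_le, Set.not_subset] at hnot
  obtain ⟨u, ⟨hun, huU, huE⟩, huV⟩ := hnot
  refine ⟨u, huU, hun, huV, ?_⟩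
  rw [hD]
  exact normalizer_le_normalizer_nilPart E huE

/-- Maximal among the proper subgroups generated by nil-elements of the whole group. -/
def IsMaximalNilPart (U : Subgroup G) : Prop :=
  Maximal (fun W : Subgroup G => W ≠ ⊤ ∧ nilPart W = W) U

theorem exists_isMaximalNilPart_ge [Finite G] {W : Subgroup G} (hW : W ≠ ⊤) :
    ∃ U, IsMaximalNilPart U ∧ nilPart W ≤ U := by
  obtain ⟨U, hU, hmax⟩ := (Set.toFinite {W : Subgroup G | W ≠ ⊤ ∧ nilPart W = W}).exists_le_maximal
    (a := nilPart W) ⟨fun h => hW (top_le_iff.mp (h ▸ nilPart_le W)), nilPart_nilPart W⟩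
  exact ⟨U, hmax, hU⟩

theorem IsMaximalNilPart.nilPart_eq {U W : Subgroup G} (hU : IsMaximalNilPart U) (hW : W ≠ ⊤)
    (h : U ≤ nilPart W) : nilPart W = U :=
  le_antisymm (hU.le_of_ge ⟨fun h => hW (top_le_iff.mp (h ▸ nilPart_le W)), nilPart_nilPart W⟩ h) h

theorem IsMaximalNilPart.not_le {U V : Subgroup G} (hU : IsMaximalNilPart U)
    (hV : IsMaximalNilPart V) (h : U ≠ V) : ¬ U ≤ V :=
  fun hle => h (hU.eq_of_le hV.prop hle)

theorem IsMaximalNilPart.map_conj {U : Subgroup G} (hU : IsMaximalNilPart U) (g : G) :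
    IsMaximalNilPart (U.map (MulAut.conj g).toMonoidHom) := by
  have key : ∀ (x : G) {W : Subgroup G}, W ≠ ⊤ ∧ nilPart W = W →
      W.map (MulAut.conj x).toMonoidHom ≠ ⊤ ∧
        nilPart (W.map (MulAut.conj x).toMonoidHom) = W.map (MulAut.conj x).toMonoidHom := by
    rintro x W ⟨h1, h2⟩
    refine ⟨fun h => h1 ?_, by rw [nilPart_map_conj, h2]⟩
    refine Subgroup.map_injective (f := (MulAut.conj x).toMonoidHom) (MulAut.conj x).injective ?_
    rw [h, Subgroup.map_top_of_surjective _ (MulAut.conj x).surjective]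
  have hinv : ∀ (x : G) (W : Subgroup G),
      (W.map (MulAut.conj x⁻¹).toMonoidHom).map (MulAut.conj x).toMonoidHom = W := by
    intro x W
    rw [Subgroup.map_map]
    convert Subgroup.map_id W
    ext y
    simp [mul_assoc]
  refine ⟨key g hU.prop, fun W hW hle => ?_⟩
  have h := hU.le_of_ge (key g⁻¹ hW) ?_
  · simpa only [hinv] using Subgroup.map_mono (f := (MulAut.conj g).toMonoidHom) h
  · have := Subgroup.map_mono (f := (MulAut.conj g⁻¹).toMonoidHom) hle
    have h := hinv g⁻¹ U
    rw [inv_inv] at h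
    rwa [h] at this

theorem exists_isMaximalNilPart_ne [Finite G] (hns : ¬ Group.IsSolvable G)
    (hG : Subgroup.closure {g : G | IsNilElement g} = ⊤) :
    ∃ U V : Subgroup G, IsMaximalNilPart U ∧ IsMaximalNilPart V ∧ U ≠ V := by
  have hz : ∀ s : G, Subgroup.zpowers s ≠ ⊤ := by
    intro s hs
    refine hns (Group.isSolvable_of_comm fun a b => ?_)
    obtain ⟨i, rfl⟩ := Subgroup.mem_zpowers_iff.mp (hs ▸ Subgroup.mem_top a)
    obtain ⟨j, rfl⟩ := Subgroup.mem_zpowers_iff.mp (hs ▸ Subgroup.mem_top b)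
    exact (Commute.refl s).zpow_zpow i j
  by_contra! hall
  obtain ⟨U, hU, -⟩ := exists_isMaximalNilPart_ge (hz 1)
  refine hU.prop.1 (top_le_iff.mp (hG.ge.trans ((Subgroup.closure_le _).mpr fun s hs => ?_)))
  obtain ⟨V, hV, hle⟩ := exists_isMaximalNilPart_ge (hz s)
  exact hall V U hV hU ▸ hle (IsNilElement.mem_nilPart hs (Subgroup.mem_zpowers s))

theorem IsMaximalNilPart.nilPart_inf_eq_bot [Finite G]
    (hnil : ∀ W : Subgroup G, W ≠ ⊤ → Group.IsNilpotent (nilPart W))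
    (hsimple : ∀ N : Subgroup G, N.Normal → Group.IsSolvable N → N = ⊥)
    {U V : Subgroup G} (hU : IsMaximalNilPart U) (hV : IsMaximalNilPart V) (hne : U ≠ V) :
    nilPart (U ⊓ V) = ⊥ := by
  obtain ⟨⟨U', V'⟩, ⟨hU', hV', hne'⟩, hmax⟩ := Set.exists_max_image
    {p : Subgroup G × Subgroup G | IsMaximalNilPart p.1 ∧ IsMaximalNilPart p.2 ∧ p.1 ≠ p.2}
    (fun p => Nat.card (nilPart (p.1 ⊓ p.2))) (Set.toFinite _) ⟨(U, V), hU, hV, hne⟩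
  simp only at hU' hV' hne' hmax
  have hU'n : Group.IsNilpotent U' := hU'.prop.2 ▸ hnil U' hU'.prop.1
  have hV'n : Group.IsNilpotent V' := hV'.prop.2 ▸ hnil V' hV'.prop.1
  have key : ∀ X A B : Subgroup G, IsMaximalNilPart X → IsMaximalNilPart A → A ≠ B →
      A ⊓ B = U' ⊓ V' → nilPart (Subgroup.normalizer (nilPart (U' ⊓ V') : Set G)) ≤ X →
      (∃ u ∈ A, IsNilElement u ∧ u ∉ B ∧
        u ∈ Subgroup.normalizer (nilPart (A ⊓ B) : Set G)) → X = A := by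
    intro X A B hX hA hAB hAB' hXN ⟨u, huA, hu, huB, huN⟩
    by_contra hXA
    have hDX : nilPart (U' ⊓ V') ≤ X :=
      (nilPart_nilPart (U' ⊓ V')).ge.trans ((nilPart_mono Subgroup.le_normalizer).trans hXN)
    have hle : nilPart (U' ⊓ V') ≤ nilPart (X ⊓ A) := by
      rw [← nilPart_nilPart (U' ⊓ V')]
      exact nilPart_mono (le_inf hDX (hAB' ▸ (nilPart_le _).trans inf_le_left))
    have heq := Subgroup.eq_of_le_of_card_ge hle (hmax (X, A) ⟨hX, hA, hXA⟩)
    have huD : u ∈ nilPart (U' ⊓ V') :=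
      heq ▸ hu.mem_nilPart ⟨hXN (hu.mem_nilPart (hAB' ▸ huN)), huA⟩
    exact huB ((nilPart_le _ (hAB' ▸ huD : u ∈ nilPart (A ⊓ B))).2)
  have hbot : nilPart (U' ⊓ V') = ⊥ := by
    have hn : Group.IsNilpotent (nilPart (U' ⊓ V')) :=
      hnil _ fun h => hU'.prop.1 (top_le_iff.mp (h ▸ inf_le_left))
    refine hsimple _ ?_ inferInstance
    by_contra hnn
    rw [← Subgroup.normalizer_eq_top_iff] at hnn
    obtain ⟨X, hX, hXN⟩ := exists_isMaximalNilPart_ge hnn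
    have h1 := key X U' V' hX hU' hne' rfl hXN
      (exists_isNilElement_mem_normalizer hU'.prop.2 (hU'.not_le hV' hne'))
    have h2 := key X V' U' hX hV' hne'.symm (inf_comm _ _) hXN
      (exists_isNilElement_mem_normalizer hV'.prop.2 (hV'.not_le hU' hne'.symm))
    exact hne' (h1 ▸ h2)
  have h := hmax (U, V) ⟨hU, hV, hne⟩
  simp only [hbot, Subgroup.card_bot] at h
  exact Subgroup.card_le_one_iff_eq_bot _ |>.mp h

theorem IsMaximalNilPart.exists_isNilElement_ne_one (hns : ¬ Group.IsSolvable G) [Finite G]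
    (hG : Subgroup.closure {g : G | IsNilElement g} = ⊤)
    {U : Subgroup G} (hU : IsMaximalNilPart U) : ∃ u ∈ U, IsNilElement u ∧ u ≠ 1 := by
  by_contra! h
  have hUbot : U = ⊥ := by
    rw [← hU.prop.2, eq_bot_iff]
    exact (Subgroup.closure_le _).mpr fun u hu => Subgroup.mem_bot.mpr (h u hu.2 hu.1)
  obtain ⟨V, W, hV, hW, hne⟩ := exists_isMaximalNilPart_ne hns hG
  have : ∀ X, IsMaximalNilPart X → X = ⊥ := fun X hX =>
    (hUbot ▸ hU.eq_of_le hX.prop (hUbot ▸ bot_le)).symm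
  exact hne ((this V hV).trans (this W hW).symm)

theorem IsMaximalNilPart.mem_normalizer_of_conj_mem [Finite G]
    (hnil : ∀ W : Subgroup G, W ≠ ⊤ → Group.IsNilpotent (nilPart W))
    (hsimple : ∀ N : Subgroup G, N.Normal → Group.IsSolvable N → N = ⊥)
    {U : Subgroup G} (hU : IsMaximalNilPart U) {u g : G} (huU : u ∈ U) (hu : IsNilElement u)
    (hu1 : u ≠ 1) (h : g * u * g⁻¹ ∈ U) : g ∈ Subgroup.normalizer (U : Set G) := by
  rw [Subgroup.mem_normalizer_iff_map_conj_eq]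
  by_contra hne
  have := (hU.map_conj g).nilPart_inf_eq_bot hnil hsimple hU hne
  have hmem := (hu.conj g).mem_nilPart (W := U.map (MulAut.conj g).toMonoidHom ⊓ U)
    ⟨⟨u, huU, rfl⟩, h⟩
  rw [this, Subgroup.mem_bot, conj_eq_one_iff] at hmem
  exact hu1 hmem

/-- **Baer**: a finite group generated by nil-elements is solvable. -/
theorem isSolvable_of_finite (m : ℕ) {G : Type*} [Group G] [Finite G] (hm : Nat.card G ≤ m)
    (hG : Subgroup.closure {g : G | IsNilElement g} = ⊤) : Group.IsSolvable G := by
  induction m generalizing G with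
  | zero => exact absurd hm (Nat.card_pos (α := G)).not_ge
  | succ m ih =>
  by_contra hns
  have hnil : ∀ W : Subgroup G, W ≠ ⊤ → Group.IsNilpotent (nilPart W) := by
    intro W hW
    have hcard : Nat.card (nilPart W) ≤ m := by
      by_contra! hlt
      refine hW (top_le_iff.mp (le_trans ?_ (nilPart_le W)))
      exact (Subgroup.eq_top_of_le_card _ (by omega)).ge
    have := ih hcard (closure_isNilElement_nilPart W)
    exact isNilpotent_of_finite_of_isSolvable (closure_isNilElement_nilPart W)
  have hsimple : ∀ N : Subgroup G, N.Normal → Group.IsSolvable N → N = ⊥ := by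
    intro N hN hNs
    by_contra hbot
    refine hns ((Group.isSolvable_iff_subgroup_quotient N).mpr ⟨hNs, ih ?_ ?_⟩)
    · have h1 := Subgroup.card_eq_card_quotient_mul_card_subgroup N
      have h2 := (Subgroup.one_lt_card_iff_ne_bot N).mpr hbot
      have h3 := Nat.card_pos (α := G ⧸ N)
      nlinarith
    · exact top_le_iff.mp ((closure_image_mk'_eq_top hG N).ge.trans
        (Subgroup.closure_mono (forall_isNilElement_image_mk' (fun _ h => h) N)))
  obtain ⟨U, V, hU, hV, hne⟩ := exists_isMaximalNilPart_ne hns hG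
  obtain ⟨u, huU, hu, hu1⟩ := hU.exists_isNilElement_ne_one hns hG
  obtain ⟨v, hvV, hv, hv1⟩ := hV.exists_isNilElement_ne_one hns hG
  have hNtop : Subgroup.normalizer (U : Set G) ≠ ⊤ := by
    intro h
    have : Group.IsNilpotent U := hU.prop.2 ▸ hnil U hU.prop.1
    have := hsimple U (Subgroup.normalizer_eq_top_iff.mp h) inferInstance
    exact hu1 (Subgroup.mem_bot.mp (this ▸ huU))
  have hNU : nilPart (Subgroup.normalizer (U : Set G)) = U :=
    hU.nilPart_eq hNtop (hU.prop.2.ge.trans (nilPart_mono Subgroup.le_normalizer))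
  have hback : ∀ i, engelWord i v u ∈ Subgroup.normalizer (U : Set G) →
      v ∈ Subgroup.normalizer (U : Set G) := by
    intro i
    induction i with
    | zero => exact id
    | succ i ihi =>
      intro h
      refine ihi (inv_mem_iff.mp ?_)
      refine hU.mem_normalizer_of_conj_mem hnil hsimple huU hu hu1 ?_
      rw [← hNU]
      refine (hu.conj _).mem_nilPart ?_
      have huN : u ∈ Subgroup.normalizer (U : Set G) := Subgroup.le_normalizer huU
      simpa [engelWord, mul_assoc] using inv_mem (mul_mem h (inv_mem huN))
  obtain ⟨k, -, hk⟩ := hu v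
  have hvU : v ∈ U := hNU ▸ hv.mem_nilPart (hback k (hk ▸ one_mem _))
  have := hv.mem_nilPart (W := U ⊓ V) ⟨hvU, hvV⟩
  rw [hU.nilPart_inf_eq_bot hnil hsimple hV hne] at this
  exact hv1 (Subgroup.mem_bot.mp this)

end

/-- A finite group generated by nil-elements is nilpotent. -/
theorem isNilpotent_of_finite {G : Type*} [Group G] [Finite G]
    (hG : Subgroup.closure {g : G | IsNilElement g} = ⊤) : Group.IsNilpotent G :=
  have := isSolvable_of_finite _ le_rfl hG
  isNilpotent_of_finite_of_isSolvable hG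

section

open scoped commutatorElement

theorem map_subtype_derivedSeries_commutator (G : Type*) [Group G] (m : ℕ) :
    (derivedSeries (commutator G) m).map (commutator G).subtype = derivedSeries G (m + 1) := by
  induction m with
  | zero => rw [derivedSeries_one, derivedSeries_zero, ← MonoidHom.range_eq_map, Subgroup.range_subtype]
  | succ m ih => rw [derivedSeries_succ, Subgroup.map_commutator, ih, ← derivedSeries_succ]

theorem map_commutatorElement_eq_one_of_commute {G M : Type*} [Group G] [Monoid M] (f : G →* M)
    {a b : G} (h : Commute (f a) (f b)) : f ⁅a, b⁆ = 1 := by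
  have h1 : ⁅a, b⁆ = a * b * (b * a)⁻¹ := by group
  rw [h1, map_mul, map_mul, h.eq, ← map_mul, ← map_mul, mul_inv_cancel, map_one]

/-- The action of a subgroup on an invariant subspace. -/
def restrictInvariant {k V G : Type*} [Field k] [AddCommGroup V] [Module k V] [Group G]
    (ρ : G →* Module.End k V) (E : Submodule k V) (hE : ∀ g, ∀ v ∈ E, ρ g v ∈ E) :
    G →* Module.End k E where
  toFun g := (ρ g).restrict (hE g)
  map_one' := by ext; simp
  map_mul' a b := by ext; simp

/-- The action of a group on the quotient by an invariant subspace. -/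
def quotientInvariant {k V G : Type*} [Field k] [AddCommGroup V] [Module k V] [Group G]
    (ρ : G →* Module.End k V) (E : Submodule k V) (hE : ∀ g, ∀ v ∈ E, ρ g v ∈ E) :
    G →* Module.End k (V ⧸ E) where
  toFun g := E.mapQ E (ρ g) (hE g)
  map_one' := by ext; simp
  map_mul' a b := by ext; simp

/-- A nilpotent group which acts on a vector space over an algebraically closed field either acts by
scalars, or its commutator subgroup leaves invariant a proper nonzero subspace. -/
theorem exists_commutator_invariant {k V N : Type*} [Field k] [IsAlgClosed k] [AddCommGroup V]
    [Module k V] [FiniteDimensional k V] [Group N] [Group.IsNilpotent N]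
    (ρ : N →* Module.End k V) :
    (∀ g, ∃ c : k, ρ g = algebraMap k _ c) ∨
      ∃ E : Submodule k V, E ≠ ⊥ ∧ E ≠ ⊤ ∧ ∀ g ∈ commutator N, ∀ v ∈ E, ρ g v ∈ E := by
  by_contra! ⟨⟨g, hg⟩, hE⟩
  obtain ⟨i, hi, hi'⟩ : ∃ i, (∀ z ∈ Subgroup.upperCentralSeries N i, ∃ c : k, ρ z = algebraMap k _ c) ∧
      ¬ ∀ z ∈ Subgroup.upperCentralSeries N (i + 1), ∃ c : k, ρ z = algebraMap k _ c := by
    by_contra! h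
    obtain ⟨m, hm⟩ := Group.IsNilpotent.nilpotent (G := N)
    have hall : ∀ i, ∀ z ∈ Subgroup.upperCentralSeries N i, ∃ c : k, ρ z = algebraMap k _ c := by
      intro i
      induction i with
      | zero =>
        intro z hz
        rw [Subgroup.upperCentralSeries_zero, Subgroup.mem_bot] at hz
        exact ⟨1, by rw [hz, map_one, map_one]⟩
      | succ i ih => exact h i ih
    obtain ⟨c, hc⟩ := hall m g (hm ▸ Subgroup.mem_top g)
    exact hg c hc
  push Not at hi'
  obtain ⟨z, hz, hzs⟩ := hi'
  have hV : Nontrivial V := by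
    by_contra h
    rw [not_nontrivial_iff_subsingleton] at h
    exact hzs 0 (Subsingleton.elim _ _)
  have hcomm : ∀ y, ∃ c : k, ρ z * ρ y = c • (ρ y * ρ z) := by
    intro y
    obtain ⟨c, hc⟩ := hi _ (Subgroup.mem_upperCentralSeries_succ_iff.mp hz y)
    refine ⟨c, ?_⟩
    have : z * y = ⁅z, y⁆ * (y * z) := by group
    rw [← map_mul, this, map_mul, hc, map_mul, ← Algebra.smul_def]
  have hle : commutator N ≤ (Subgroup.centralizer {ρ.toHomUnits z}).comap ρ.toHomUnits := by
    refine Subgroup.commutator_le.mpr fun a _ b _ => ?_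
    rw [Subgroup.mem_comap, Subgroup.mem_centralizer_singleton_iff]
    obtain ⟨ca, ha⟩ := hcomm a
    obtain ⟨cb, hb⟩ := hcomm b
    have hab : ρ z * (ρ a * ρ b) = (ca * cb) • (ρ a * ρ b * ρ z) := by
      rw [← mul_assoc, ha, smul_mul_assoc, mul_assoc, hb, mul_smul_comm, smul_smul, mul_assoc]
    have hba : ρ z * (ρ b * ρ a) = (ca * cb) • (ρ b * ρ a * ρ z) := by
      rw [← mul_assoc, hb, smul_mul_assoc, mul_assoc, ha, mul_smul_comm, smul_smul, mul_assoc,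
        mul_comm cb]
    have hw : ρ ⁅a, b⁆ * (ρ b * ρ a) = ρ a * ρ b := by
      rw [← map_mul, ← map_mul, ← map_mul, commutatorElement_def]
      congr 1
      group
    refine mul_right_cancel (b := ρ.toHomUnits (b * a)) (Units.ext ?_)
    simp only [Units.val_mul, MonoidHom.coe_toHomUnits, map_mul (f := ρ) b a]
    rw [mul_assoc, hba, mul_smul_comm, ← mul_assoc (ρ _) (ρ b * ρ a), hw, ← hab, mul_assoc, hw]
  obtain ⟨μ, hμ⟩ := Module.End.exists_eigenvalue (ρ z)
  obtain ⟨w, hw, v, hv, hwv⟩ := hE (Module.End.eigenspace (ρ z) μ) hμ (fun h => hzs μ (by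
    ext v
    have : v ∈ Module.End.eigenspace (ρ z) μ := h ▸ Submodule.mem_top
    rw [Module.End.mem_eigenspace_iff] at this
    simpa using this))
  refine hwv ?_
  have h := Subgroup.mem_centralizer_singleton_iff.mp (hle hw)
  have h' := congrArg (fun u : (Module.End k V)ˣ => (u : Module.End k V) v) h
  simp only [Units.val_mul, MonoidHom.coe_toHomUnits, Module.End.mul_apply] at h'
  rw [Module.End.mem_eigenspace_iff] at hv ⊢
  rw [hv, map_smul] at h'
  exact h'.symm

/-- A nilpotent group acting on a space of dimension at most `d` over an algebraically closed field
acts through a quotient of derived length at most `2 * d`. -/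
theorem derivedSeries_le_ker_of_finrank_le (d : ℕ) {k V N : Type*} [Field k] [IsAlgClosed k]
    [AddCommGroup V] [Module k V] [FiniteDimensional k V] [Group N] [Group.IsNilpotent N]
    (ρ : N →* Module.End k V) (hd : Module.finrank k V ≤ d) :
    derivedSeries N (2 * d) ≤ ρ.ker := by
  induction d generalizing V N with
  | zero =>
    have := Module.finrank_zero_iff.mp (Nat.le_zero.mp hd)
    exact fun x _ => MonoidHom.mem_ker.mpr (Subsingleton.elim _ _)
  | succ d ih =>
    rcases exists_commutator_invariant ρ with h | ⟨E, hbot, htop, hE⟩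
    · refine (derivedSeries_antitone N (by omega : 1 ≤ 2 * (d + 1))).trans ?_
      refine Subgroup.commutator_le.mpr fun a _ b _ => MonoidHom.mem_ker.mpr ?_
      refine map_commutatorElement_eq_one_of_commute ρ ?_
      obtain ⟨c, hc⟩ := h a
      rw [hc]
      exact Algebra.commutes c _
    · let ρ' := ρ.comp (commutator N).subtype
      have hE' : ∀ g, ∀ v ∈ E, ρ' g v ∈ E := fun g => hE g g.2
      have hlt := Submodule.finrank_lt htop
      have hadd := Submodule.finrank_quotient_add_finrank E
      have hpos : 0 < Module.finrank k E := Module.finrank_pos_iff.mpr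
        ((Submodule.nontrivial_iff_ne_bot).mpr hbot)
      have h1 := ih (restrictInvariant ρ' E hE') (by omega)
      have h2 := ih (quotientInvariant ρ' E hE') (by omega)
      rw [show 2 * (d + 1) = 2 * d + 1 + 1 by ring, ← map_subtype_derivedSeries_commutator,
        Subgroup.map_le_iff_le_comap, derivedSeries_succ]
      refine Subgroup.commutator_le.mpr fun a ha b hb => ?_
      refine MonoidHom.mem_ker.mpr (map_commutatorElement_eq_one_of_commute ρ' ?_)
      have hfix : ∀ a ∈ derivedSeries (commutator N) (2 * d), ∀ v ∈ E, ρ' a v = v := by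
        intro a ha v hv
        exact congrArg Subtype.val (LinearMap.congr_fun (MonoidHom.mem_ker.mp (h1 ha)) ⟨v, hv⟩)
      have hsub : ∀ a ∈ derivedSeries (commutator N) (2 * d), ∀ v, ρ' a v - v ∈ E := by
        intro a ha v
        exact (Submodule.Quotient.eq E).mp
          (LinearMap.congr_fun (MonoidHom.mem_ker.mp (h2 ha)) (Submodule.Quotient.mk v))
      have key : ∀ a ∈ derivedSeries (commutator N) (2 * d),
          ∀ b ∈ derivedSeries (commutator N) (2 * d), ∀ v,
            ρ' a (ρ' b v) = ρ' b v - v + ρ' a v := by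
        intro a ha b hb v
        have h := hfix a ha _ (hsub b hb v)
        rw [map_sub] at h
        rw [← h, sub_add_cancel]
      ext v
      rw [Module.End.mul_apply, Module.End.mul_apply, key a ha b hb, key b hb a ha]
      abel

end

theorem isJacobsonRing_int : IsJacobsonRing ℤ := by
  refine isJacobsonRing_iff_prime_eq.mpr fun P hP => ?_
  by_cases hbot : P = ⊥
  · rw [hbot, eq_bot_iff]
    intro x hx
    have h := Int.isUnit_iff.mp (Ideal.mem_jacobson_bot.mp hx x)
    have h' := Int.isUnit_iff.mp (Ideal.mem_jacobson_bot.mp hx (2 * x))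
    rw [Ideal.mem_bot]
    rcases h with h | h <;> rcases h' with h' | h' <;> nlinarith
  · have := hP.isMaximal hbot
    exact Ideal.jacobson_eq_self_of_isMaximal

theorem finite_of_module_finite_int (F : Type*) [Field F] [Module.Finite ℤ F] : Finite F := by
  by_cases hinj : Function.Injective (algebraMap ℤ F)
  · exact absurd (isField_of_isIntegral_of_isField hinj (Field.toIsField F)) Int.not_isField
  · rw [injective_iff_map_eq_zero] at hinj
    push Not at hinj
    obtain ⟨m, hm, hm0⟩ := hinj
    refine Module.finite_of_fg_torsion F fun x => ⟨⟨m, mem_nonZeroDivisors_of_ne_zero hm0⟩, ?_⟩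
    rw [Submonoid.mk_smul, Algebra.smul_def, hm, zero_mul]

theorem closure_isNilElement_eq_top_of_surjective {G H : Type*} [Group G] [Group H] {f : G →* H}
    (hf : Function.Surjective f) (hG : Subgroup.closure {g : G | IsNilElement g} = ⊤) :
    Subgroup.closure {g : H | IsNilElement g} = ⊤ := by
  rw [eq_top_iff, ← MonoidHom.range_eq_top_of_surjective f hf, MonoidHom.range_eq_map, ← hG,
    MonoidHom.map_closure]
  refine Subgroup.closure_mono ?_
  rintro _ ⟨g, hg, rfl⟩
  exact IsNilElement.map hf hg

theorem generalLinearGroup_map_injective {n : Type*} [DecidableEq n] [Fintype n] {R S : Type*}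
    [CommRing R] [CommRing S] {f : R →+* S} (hf : Function.Injective f) :
    Function.Injective (Matrix.GeneralLinearGroup.map (n := n) f) := by
  intro a b hab
  refine Matrix.GeneralLinearGroup.ext fun i j => hf ?_
  rw [← Matrix.GeneralLinearGroup.map_apply, hab, Matrix.GeneralLinearGroup.map_apply]

theorem derivedSeries_le_ker_of_finite_field {F Γ : Type*} [Field F] [Finite F] [Group Γ] {n : ℕ}
    (f : Γ →* Matrix.GeneralLinearGroup (Fin n) F)
    (hΓ : Subgroup.closure {g : Γ | IsNilElement g} = ⊤) : derivedSeries Γ (2 * n) ≤ f.ker := by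
  have : Group.IsNilpotent f.range := isNilpotent_of_finite
    (closure_isNilElement_eq_top_of_surjective f.rangeRestrict_surjective hΓ)
  let φ : f.range →* LinearMap.GeneralLinearGroup (AlgebraicClosure F) (Fin n → AlgebraicClosure F) :=
    Matrix.GeneralLinearGroup.toLin.toMonoidHom.comp
      ((Matrix.GeneralLinearGroup.map (algebraMap F (AlgebraicClosure F))).comp f.range.subtype)
  have hφ : Function.Injective φ :=
    Matrix.GeneralLinearGroup.toLin.injective.comp ((generalLinearGroup_map_injective
      (algebraMap F (AlgebraicClosure F)).injective).comp f.range.subtype_injective)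
  have h := derivedSeries_le_ker_of_finrank_le n ((Units.coeHom _).comp φ)
    (Module.finrank_fin_fun _).le
  intro x hx
  have h1 := h (map_derivedSeries_le_derivedSeries f.rangeRestrict _ (Subgroup.mem_map_of_mem _ hx))
  have h2 : φ (f.rangeRestrict x) = 1 := Units.ext (MonoidHom.mem_ker.mp h1)
  have h3 := hφ (h2.trans (map_one φ).symm)
  exact congrArg Subtype.val h3

theorem derivedSeries_le_ker_of_finiteType {R Γ : Type*} [CommRing R] [IsReduced R]
    [Algebra.FiniteType ℤ R] [Group Γ] {n : ℕ} (f : Γ →* Matrix.GeneralLinearGroup (Fin n) R)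
    (hΓ : Subgroup.closure {g : Γ | IsNilElement g} = ⊤) : derivedSeries Γ (2 * n) ≤ f.ker := by
  have := isJacobsonRing_int
  have : IsJacobsonRing R := isJacobsonRing_of_finiteType (A := ℤ)
  intro x hx
  refine MonoidHom.mem_ker.mpr (Matrix.GeneralLinearGroup.ext fun i j => sub_eq_zero.mp ?_)
  have hjac : (⊥ : Ideal R).jacobson = ⊥ := by
    rw [← Ideal.radical_eq_jacobson, ← Ideal.zero_eq_bot]
    exact nilradical_eq_zero R
  rw [← Ideal.mem_bot, ← hjac, Ideal.jacobson, Ideal.mem_sInf]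
  rintro m ⟨-, hm⟩
  let := Ideal.Quotient.field m
  have : Algebra.FiniteType ℤ (R ⧸ m) :=
    Algebra.FiniteType.of_surjective (Ideal.Quotient.mkₐ ℤ m) Ideal.Quotient.mk_surjective
  have := finite_of_finite_type_of_isJacobsonRing ℤ (R ⧸ m)
  have := finite_of_module_finite_int (R ⧸ m)
  have h := derivedSeries_le_ker_of_finite_field
    ((Matrix.GeneralLinearGroup.map (Ideal.Quotient.mk m)).comp f) hΓ hx
  rw [← Ideal.Quotient.eq_zero_iff_mem, map_sub, sub_eq_zero,
    ← Matrix.GeneralLinearGroup.map_apply, ← Matrix.GeneralLinearGroup.map_apply, map_one]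
  exact congrArg (fun g : Matrix.GeneralLinearGroup (Fin n) (R ⧸ m) => g i j)
    (MonoidHom.mem_ker.mp h)

theorem exists_fg_subalgebra_le_range_map {K : Type*} [CommRing K] {n : Type*} [Fintype n]
    [DecidableEq n] {T : Set (Matrix.GeneralLinearGroup n K)} (hT : T.Finite) :
    ∃ R : Subalgebra ℤ K, R.FG ∧
      Subgroup.closure T ≤ (Matrix.GeneralLinearGroup.map (n := n) (R.val : R →+* K)).range := by
  let E : Set K := ⋃ g ∈ T, Set.range fun p : n × n => (g : Matrix n n K) p.1 p.2
  let E' : Set K := ⋃ g ∈ T, Set.range fun p : n × n => (g⁻¹ : Matrix.GeneralLinearGroup n K) p.1 p.2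
  have hE : (E ∪ E').Finite :=
    (hT.biUnion fun _ _ => Set.finite_range _).union (hT.biUnion fun _ _ => Set.finite_range _)
  refine ⟨Algebra.adjoin ℤ (E ∪ E'), Subalgebra.fg_def.mpr ⟨_, hE, rfl⟩,
    (Subgroup.closure_le _).mpr fun g hg => ?_⟩
  have h1 : ∀ i j, g i j ∈ Algebra.adjoin ℤ (E ∪ E') := fun i j =>
    Algebra.subset_adjoin (Or.inl (Set.mem_biUnion hg ⟨(i, j), rfl⟩))
  have h2 : ∀ i j, g⁻¹ i j ∈ Algebra.adjoin ℤ (E ∪ E') := fun i j =>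
    Algebra.subset_adjoin (Or.inr (Set.mem_biUnion hg ⟨(i, j), rfl⟩))
  refine ⟨⟨Matrix.of fun i j => ⟨g i j, h1 i j⟩, Matrix.of fun i j => ⟨g⁻¹ i j, h2 i j⟩, ?_, ?_⟩, ?_⟩
  · ext i j
    have := congrArg (fun M : Matrix n n K => M i j) g.mul_inv
    simpa [Matrix.mul_apply, Matrix.one_apply, apply_ite] using this
  · ext i j
    have := congrArg (fun M : Matrix n n K => M i j) g.inv_mul
    simpa [Matrix.mul_apply, Matrix.one_apply, apply_ite] using this
  · ext i j
    rfl

theorem derivedSeries_le_ker_of_fg {K Γ : Type*} [CommRing K] [IsReduced K] [Group Γ] [Group.FG Γ]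
    {n : ℕ} (f : Γ →* Matrix.GeneralLinearGroup (Fin n) K)
    (hΓ : Subgroup.closure {g : Γ | IsNilElement g} = ⊤) : derivedSeries Γ (2 * n) ≤ f.ker := by
  obtain ⟨T, hT, hTfin⟩ := Group.fg_iff.mp ‹Group.FG Γ›
  obtain ⟨R, hR, hle⟩ := exists_fg_subalgebra_le_range_map (hTfin.image f)
  rw [← MonoidHom.map_closure, hT, ← MonoidHom.range_eq_map] at hle
  have : Algebra.FiniteType ℤ R := (Subalgebra.fg_iff_finiteType R).mp hR
  have hinj : Function.Injective (Matrix.GeneralLinearGroup.map (n := Fin n) (R.val : R →+* K)) :=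
    generalLinearGroup_map_injective Subtype.val_injective
  have : IsReduced R := isReduced_of_injective (R.val : R →+* K) Subtype.val_injective
  let φ : Γ →* Matrix.GeneralLinearGroup (Fin n) R :=
    (MonoidHom.ofInjective hinj).symm.toMonoidHom.comp
      ((Subgroup.inclusion hle).comp f.rangeRestrict)
  intro x hx
  have h := derivedSeries_le_ker_of_finiteType φ hΓ hx
  have h1 : Subgroup.inclusion hle (f.rangeRestrict x) = 1 :=
    (MonoidHom.ofInjective hinj).symm.injective
      ((MonoidHom.mem_ker.mp h).trans (map_one (MonoidHom.ofInjective hinj).symm).symm)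
  exact congrArg Subtype.val h1

theorem exists_finite_mem_map_derivedSeries_closure {Γ : Type*} [Group Γ] {S : Set Γ}
    (hS : Subgroup.closure S = ⊤) (m : ℕ) {x : Γ} (hx : x ∈ derivedSeries Γ m) :
    ∃ T ⊆ S, T.Finite ∧
      x ∈ (derivedSeries (Subgroup.closure T) m).map (Subgroup.closure T).subtype := by
  let D (m : ℕ) (T : {T : Set Γ // T ⊆ S ∧ T.Finite}) : Subgroup Γ :=
    (derivedSeries (Subgroup.closure T.1) m).map (Subgroup.closure T.1).subtype
  have hmono : ∀ m, Monotone (D m) := by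
    intro m T U h
    have h' := Subgroup.closure_mono h
    have := Subgroup.map_mono (f := (Subgroup.closure U.1).subtype)
      (map_derivedSeries_le_derivedSeries (Subgroup.inclusion h') m)
    rwa [Subgroup.map_map, Subgroup.subtype_comp_inclusion] at this
  have hne : Nonempty {T : Set Γ // T ⊆ S ∧ T.Finite} := ⟨⟨∅, Set.empty_subset _, Set.finite_empty⟩⟩
  have hsup : ∀ T U : {T : Set Γ // T ⊆ S ∧ T.Finite}, ∃ W, T ≤ W ∧ U ≤ W := fun T U =>
    ⟨⟨T.1 ∪ U.1, Set.union_subset T.2.1 U.2.1, T.2.2.union U.2.2⟩, Set.subset_union_left,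
      Set.subset_union_right⟩
  have hdir : ∀ m, Directed (· ≤ ·) (D m) := fun m T U =>
    (hsup T U).imp fun W h => ⟨hmono m h.1, hmono m h.2⟩
  have hle : derivedSeries Γ m ≤ ⨆ T, D m T := by
    clear hx
    induction m with
    | zero =>
      intro y _
      obtain ⟨T, hTS, hT, hy⟩ := exists_finite_subset_mem_closure (hS ▸ Subgroup.mem_top y)
      exact (Subgroup.mem_iSup_of_directed (hdir 0)).mpr ⟨⟨T, hTS, hT⟩, ⟨y, hy⟩, trivial, rfl⟩
    | succ m ih =>
      refine Subgroup.commutator_le.mpr fun a ha b hb => ?_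
      obtain ⟨T, hT⟩ := (Subgroup.mem_iSup_of_directed (hdir m)).mp (ih ha)
      obtain ⟨U, hU⟩ := (Subgroup.mem_iSup_of_directed (hdir m)).mp (ih hb)
      obtain ⟨W, hTW, hUW⟩ := hsup T U
      refine (Subgroup.mem_iSup_of_directed (hdir (m + 1))).mpr ⟨W, ?_⟩
      simp only [D, derivedSeries_succ, Subgroup.map_commutator]
      exact Subgroup.commutator_mem_commutator (hmono m hTW hT) (hmono m hUW hU)
  obtain ⟨T, hT⟩ := (Subgroup.mem_iSup_of_directed (hdir m)).mp (hle hx)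
  exact ⟨T.1, T.2.1, T.2.2, hT⟩

/-- A linear group of degree `n` over a reduced commutative ring which is generated by nil-elements
has derived length at most `2 * n`. -/
theorem derivedSeries_le_ker_of_isReduced {K Γ : Type*} [CommRing K] [IsReduced K] [Group Γ] {n : ℕ}
    (f : Γ →* Matrix.GeneralLinearGroup (Fin n) K)
    (hΓ : Subgroup.closure {g : Γ | IsNilElement g} = ⊤) : derivedSeries Γ (2 * n) ≤ f.ker := by
  intro x hx
  obtain ⟨T, hTS, hT, y, hy, rfl⟩ := exists_finite_mem_map_derivedSeries_closure hΓ _ hx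
  have : Group.FG (Subgroup.closure T) :=
    (Group.fg_iff_subgroup_fg _).mpr ((Subgroup.fg_iff _).mpr ⟨T, rfl, hT⟩)
  refine derivedSeries_le_ker_of_fg (f.comp (Subgroup.closure T).subtype) ?_ hy
  refine top_le_iff.mp ((Subgroup.closure_closure_coe_preimage (k := T)).ge.trans
    (Subgroup.closure_mono fun g hg => ?_))
  exact IsNilElement.of_map (f := (Subgroup.closure T).subtype) Subtype.val_injective (hTS hg)

/-- in a subgroup `G` of `GL_n(K)`, `K` a product of fields, the subgroup
generated by all nil-elements is a solvable, locally nilpotent normal subgroup. -/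
theorem closure_nilElements_solvable_locallyNilpotent_prodFields {I : Type*}
    (P : I → Type*) [∀ α, Field (P α)] (n : ℕ) (hn : 1 ≤ n)
    (G : Subgroup (Matrix.GeneralLinearGroup (Fin n) (∀ α, P α))) :
    (Subgroup.closure {g : G | IsNilElement g}).Normal ∧
      IsSolvable (Subgroup.closure {g : G | IsNilElement g}) ∧
      LocallyNilpotent (Subgroup.closure {g : G | IsNilElement g}) := by
  have hnil : ∀ g ∈ (Subtype.val ⁻¹' {g : G | IsNilElement g} :
      Set (Subgroup.closure {g : G | IsNilElement g})), IsNilElement g := fun g hg =>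
    IsNilElement.of_map (f := (Subgroup.closure {g : G | IsNilElement g}).subtype)
      Subtype.val_injective hg
  have hgen : Subgroup.closure (Subtype.val ⁻¹' {g : G | IsNilElement g} :
      Set (Subgroup.closure {g : G | IsNilElement g})) = ⊤ := Subgroup.closure_closure_coe_preimage
  have hsol : Group.IsSolvable (Subgroup.closure {g : G | IsNilElement g}) := by
    refine ⟨2 * n, eq_bot_iff.mpr ?_⟩
    refine (derivedSeries_le_ker_of_isReduced
      (G.subtype.comp (Subgroup.closure {g : G | IsNilElement g}).subtype)
      (top_le_iff.mp (hgen.ge.trans (Subgroup.closure_mono hnil)))).trans ?_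
    exact ((MonoidHom.ker_eq_bot_iff _).mpr
      (Subtype.val_injective.comp Subtype.val_injective)).le
  refine ⟨?_, hsol, locallyNilpotent_of_closure_eq_top hgen hnil⟩
  rw [← Subgroup.normalizer_eq_top_iff, eq_top_iff]
  refine le_trans (fun g _ => Subgroup.mem_set_normalizer_iff.mpr fun h =>
    ⟨fun hh => hh.conj g, fun hh => ?_⟩)
    (Subgroup.normalizer_le_normalizer_closure _)
  simpa [mul_assoc] using IsNilElement.conj hh g⁻¹
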